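/- arXiv:1701.08562 — 2 statements merged into one kernel-verified Lean document; each statement's English description precedes it below -/
import Mathlib

section
/- Let T ⊂ ℝ² be a triangle, X ∈ 𝔽₂^{n×2}, and y ∈ T^{(n)}(X). For any twice continuously differentiable f : T → ℝ, |f(y) − F_n(X)| ≤ √2·d(T)·‖f‖_{C²(T)}/2^n, where d(T) is the diameter of T. -/
open MeasureTheory

noncomputable section

/-- The two-element field. -/
abbrev F2 : Type := ZMod 2

/-- Points of the plane. -/
abbrev Pt : Type := EuclideanSpace ℝ (Fin 2)

/-- The (closed) triangle with vertices `A`, `B`, `C`. -/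
def tri (A B C : Pt) : Set Pt :=
  {x | ∃ w1 w2 w3 : ℝ, 0 ≤ w1 ∧ 0 ≤ w2 ∧ 0 ≤ w3 ∧ w1 + w2 + w3 = 1 ∧
    x = w1 • A + w2 • B + w3 • C}

/-- One step of the recursive partitioning, acting on vertex triples `(A,B,C)`. -/
def subV (v : Pt × Pt × Pt) (ξ : F2 × F2) : Pt × Pt × Pt :=
  if ξ = (1, 0) then (v.1, (2:ℝ)⁻¹ • (v.1 + v.2.1), (2:ℝ)⁻¹ • (v.1 + v.2.2))
  else if ξ = (0, 1) then ((2:ℝ)⁻¹ • (v.2.1 + v.1), v.2.1, (2:ℝ)⁻¹ • (v.2.1 + v.2.2))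
  else if ξ = (1, 1) then ((2:ℝ)⁻¹ • (v.2.2 + v.1), (2:ℝ)⁻¹ • (v.2.2 + v.2.1), v.2.2)
  else ((2:ℝ)⁻¹ • (v.2.1 + v.2.2), (2:ℝ)⁻¹ • (v.2.2 + v.1), (2:ℝ)⁻¹ • (v.1 + v.2.1))

/-- Iterated partitioning along a list of pairs of bits (the rows of `X`). -/
def vIter (v : Pt × Pt × Pt) (l : List (F2 × F2)) : Pt × Pt × Pt := l.foldl subV v

/-- The subtriangle `T^{(n)}(X)` where `l` is the list of rows of `X`. -/
def subTri (v : Pt × Pt × Pt) (l : List (F2 × F2)) : Set Pt :=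
  tri (vIter v l).1 (vIter v l).2.1 (vIter v l).2.2

/-- The centre `φ^{(n)}(X)` of the subtriangle `T^{(n)}(X)`. -/
def ctr (v : Pt × Pt × Pt) (l : List (F2 × F2)) : Pt :=
  (3:ℝ)⁻¹ • ((vIter v l).1 + (vIter v l).2.1 + (vIter v l).2.2)

/-- The sign `η_i(X)` (with `i` 1-indexed, `1 ≤ i ≤ n+1`). -/
def eta {n : ℕ} (X : Fin n → F2 × F2) (i : ℕ) : ℝ :=
  (-1 : ℝ) ^ (Finset.univ.filter fun a : Fin n => (a : ℕ) + 1 < i ∧ X a = (0, 0)).card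

/-- First coordinate direction. -/
def dir1 : Pt := EuclideanSpace.single 0 1

/-- Second coordinate direction. -/
def dir2 : Pt := EuclideanSpace.single 1 1

/-- Partial derivative (within `T`) of `f` in the direction `v`. -/
def pdW (T : Set Pt) (v : Pt) (f : Pt → ℝ) : Pt → ℝ := fun x => fderivWithin ℝ f T x v

/-- Sup of `|g|` over `T`. -/
def supAbs (T : Set Pt) (g : Pt → ℝ) : ℝ := ⨆ x ∈ T, |g x|

/-- The norm `‖f‖_{C²(T)}`: the maximum over all partial derivatives of order at most 2
of the sup norm on `T`. -/
def c2Norm (T : Set Pt) (f : Pt → ℝ) : ℝ :=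
  max (supAbs T f)
    (max (max (supAbs T (pdW T dir1 f)) (supAbs T (pdW T dir2 f)))
      (max (supAbs T (pdW T dir1 (pdW T dir1 f)))
        (max (supAbs T (pdW T dir2 (pdW T dir1 f)))
          (supAbs T (pdW T dir2 (pdW T dir2 f))))))

/-- The `n`-th discretized function `F_n` of `f` (with `X` given by its rows). -/
def discF (v : Pt × Pt × Pt) {n : ℕ} (f : Pt → ℝ) (X : Fin n → F2 × F2) : ℝ :=
  (volume (subTri v (List.ofFn X))).toReal⁻¹ * ∫ y in subTri v (List.ofFn X), f y

/-- The `l`-th dyadic digit of `h`. -/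
def digit (h l : ℕ) : F2 := if Nat.testBit h l then 1 else 0

/-- The weight `μ₁(k)` of a column vector: the largest (1-indexed) position of a
nonzero entry, and `0` for the zero vector. -/
def mu1 {n : ℕ} (k : Fin n → F2) : ℕ :=
  (Finset.univ.filter fun i : Fin n => k i ≠ 0).sup fun i => (i : ℕ) + 1

/-- The weight `v(K) = max (μ₁(k₁), μ₁(k₂))` of `K` (given by its rows). -/
def vK {n : ℕ} (K : Fin n → F2 × F2) : ℕ :=
  max (mu1 fun i => (K i).1) (mu1 fun i => (K i).2)

/-- Entry `(i, j)` (0-indexed row `i`) of the point `X(h)` of the digital sequence with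
generating matrices `Cm 0`, `Cm 1` (0-indexed). -/
def Xent (Cm : Fin 2 → ℕ → ℕ → F2) (h i : ℕ) (j : Fin 2) : F2 :=
  ∑ l ∈ Finset.range (h + 1), Cm j i l * digit h l

/-- Row `i` (0-indexed) of the point `X(h)` of the digital sequence. -/
def XrowS (Cm : Fin 2 → ℕ → ℕ → F2) (h i : ℕ) : F2 × F2 :=
  (Xent Cm h i 0, Xent Cm h i 1)

/-- `ν(h)`: the number of initial rows of `X(h)` after which all rows vanish. -/
def nuF (Cm : Fin 2 → ℕ → ℕ → F2) (h : ℕ) : ℕ :=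
  sInf {q | ∀ i, q ≤ i → XrowS Cm h i = (0, 0)}

/-- The `h`-th point of the sequence `S_T` in the triangle with vertex triple `v`. -/
def seqPt (v : Pt × Pt × Pt) (Cm : Fin 2 → ℕ → ℕ → F2) (h : ℕ) : Pt :=
  ctr v (List.ofFn fun i : Fin (nuF Cm h) => XrowS Cm h (i : ℕ))

/-- Row `i` of the digital-net point `X(h)` for generating matrices `C1 C2 ∈ 𝔽₂^{n×m}`. -/
def XnetRow {n m : ℕ} (C1 C2 : Matrix (Fin n) (Fin m) F2) (h : ℕ) (i : Fin n) : F2 × F2 :=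
  (∑ l : Fin m, C1 i l * digit h (l : ℕ), ∑ l : Fin m, C2 i l * digit h (l : ℕ))

/-- The Walsh function `wal_K(X)` (for `K`, `X` given by their rows). -/
def walR {n : ℕ} (K X : Fin n → F2 × F2) : ℝ :=
  (-1 : ℝ) ^ (∑ i : Fin n, ((K i).1 * (X i).1 + (K i).2 * (X i).2)).val

/-- The `K`-th Walsh coefficient of `F : 𝔽₂^{n×2} → ℝ`. -/
def fhat {n : ℕ} (F : (Fin n → F2 × F2) → ℝ) (K : Fin n → F2 × F2) : ℝ :=
  ((4:ℝ) ^ n)⁻¹ * ∑ X : Fin n → F2 × F2, F X * walR K X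

/-- The vector `τ(κ, κ')`. -/
def tau (e : F2 × F2 → Pt) (κ κ' : F2 × F2) : Pt :=
  if κ' ≠ (0, 0) ∧ κ' ≠ κ then e (κ + κ') - e κ' else e (κ + κ') + e κ'

/-- The point shift `y ⊕_i κ` on `T^{(n)}(X)` (with `i : Fin n` the 0-indexed row,
corresponding to the 1-indexed row `i+1` of the paper). -/
def ptShift (e : F2 × F2 → Pt) {n : ℕ} (X : Fin n → F2 × F2) (i : Fin n)
    (κ : F2 × F2) (y : Pt) : Pt :=
  if X i ≠ (0, 0) ∧ X i ≠ κ then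
    y + (eta X ((i : ℕ) + 1) / 2 ^ ((i : ℕ) + 1)) • tau e κ (X i)
  else
    (2:ℝ) • ctr (e (1, 0), e (0, 1), e (1, 1)) ((List.ofFn X).take (i : ℕ)) - y +
      (eta X ((i : ℕ) + 1) / 2 ^ ((i : ℕ) + 1)) • tau e κ (X i)

/-- The map `σ : 𝔽₂² → 𝔽₂²`. -/
def sigF : F2 × F2 → F2 × F2 := fun κ =>
  if κ = (0, 0) then (1, 1) else if κ = (1, 1) then (0, 1) else κ

/-- The two-element set `P(κ) = {p₁(κ), p₂(κ)}`. -/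
def pSet (κ : F2 × F2) : Finset (F2 × F2) :=
  if κ = (0, 0) then {(0, 0), (1, 1)} else if κ = (0, 1) then {(1, 1), (1, 0)}
  else if κ = (1, 0) then {(1, 1), (0, 1)} else {(1, 0), (1, 1)}

/-- The one-row Walsh function `wal_κ(ξ)`. -/
def walRow (κ ξ : F2 × F2) : ℝ := (-1 : ℝ) ^ ((κ.1 * ξ.1 + κ.2 * ξ.2 : F2)).val

/-- The `i`-th dyadic difference `d_K^{(i)} F` (with `i : Fin n` 0-indexed, corresponding
to the 1-indexed index `i+1` of the paper). -/
def dd {n : ℕ} (K : Fin n → F2 × F2) (i : Fin n) (F : (Fin n → F2 × F2) → ℝ) :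
    (Fin n → F2 × F2) → ℝ :=
  fun X => F (Function.update X i (X i + sigF (K i))) + walRow (K i) (sigF (K i)) * F X

/-- The subset `R_w(K) ⊆ 𝔽₂^{n×2}` (here `w : ℕ` is the 1-indexed paper index,
`0 ≤ w ≤ v(K)-1`). -/
def Rset {n : ℕ} (K : Fin n → F2 × F2) (w : ℕ) : Finset (Fin n → F2 × F2) :=
  Finset.univ.filter fun X =>
    (∀ i : Fin n, w ≤ (i : ℕ) → (i : ℕ) + 1 < vK K → X i ∉ pSet (K i)) ∧
    (w = 0 ∨ ∃ j : Fin n, (j : ℕ) + 1 = w ∧ X j ∈ pSet (K j))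

/-- The Walsh coefficient of `F` on the subset `R_w(K)`. -/
def rwHat {n : ℕ} (F : (Fin n → F2 × F2) → ℝ) (K : Fin n → F2 × F2) (w : ℕ) : ℝ :=
  ((4:ℝ) ^ n)⁻¹ * ∑ X ∈ Rset K w, F X * walR K X

theorem convex_tri (A B C : Pt) : Convex ℝ (tri A B C) := by
  rintro _ ⟨u1, u2, u3, hu1, hu2, hu3, hu, rfl⟩ _ ⟨w1, w2, w3, hw1, hw2, hw3, hw, rfl⟩
    a b ha hb hab
  refine ⟨a * u1 + b * w1, a * u2 + b * w2, a * u3 + b * w3, by positivity, by positivity,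
    by positivity, ?_, by module⟩
  linear_combination a * hu + b * hw + hab

theorem vertices_mem_tri (A B C : Pt) : A ∈ tri A B C ∧ B ∈ tri A B C ∧ C ∈ tri A B C :=
  ⟨⟨1, 0, 0, by simp⟩, ⟨0, 1, 0, by simp⟩, ⟨0, 0, 1, by simp⟩⟩

theorem tri_subset_of_convex {A B C : Pt} {s : Set Pt} (hs : Convex ℝ s) (hA : A ∈ s)
    (hB : B ∈ s) (hC : C ∈ s) : tri A B C ⊆ s := by
  rintro _ ⟨w1, w2, w3, h1, h2, h3, h, rfl⟩
  have := hs.sum_mem (R := ℝ) (t := Finset.univ) (w := ![w1, w2, w3]) (z := ![A, B, C])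
    (by intro i _; fin_cases i <;> simpa) (by simpa [Fin.sum_univ_three] using h)
    (by intro i _; fin_cases i <;> simpa)
  simpa [Fin.sum_univ_three] using this

theorem tri_eq_convexHull (A B C : Pt) : tri A B C = convexHull ℝ (Set.range ![A, B, C]) := by
  obtain ⟨hA, hB, hC⟩ := vertices_mem_tri A B C
  apply Set.Subset.antisymm
  · exact tri_subset_of_convex (convex_convexHull ℝ _) (subset_convexHull ℝ _ ⟨0, rfl⟩)
      (subset_convexHull ℝ _ ⟨1, rfl⟩) (subset_convexHull ℝ _ ⟨2, rfl⟩)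
  · refine convexHull_min ?_ (convex_tri A B C)
    rintro _ ⟨i, rfl⟩
    fin_cases i <;> simpa

theorem isCompact_tri (A B C : Pt) : IsCompact (tri A B C) := by
  rw [tri_eq_convexHull]
  exact (Set.finite_range _).isCompact_convexHull ℝ

theorem interior_tri_nonempty {A B C : Pt} (hT : AffineIndependent ℝ ![A, B, C]) :
    (interior (tri A B C)).Nonempty := by
  rw [tri_eq_convexHull, interior_convexHull_nonempty_iff_affineSpan_eq_top,
    hT.affineSpan_eq_top_iff_card_eq_finrank_add_one]
  simp

theorem subV_mem_tri (v : Pt × Pt × Pt) (ξ : F2 × F2) :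
    (subV v ξ).1 ∈ tri v.1 v.2.1 v.2.2 ∧ (subV v ξ).2.1 ∈ tri v.1 v.2.1 v.2.2 ∧
      (subV v ξ).2.2 ∈ tri v.1 v.2.1 v.2.2 := by
  obtain ⟨A, B, C⟩ := v
  obtain ⟨hA, hB, hC⟩ := vertices_mem_tri A B C
  have mid : ∀ {P Q : Pt}, P ∈ tri A B C → Q ∈ tri A B C → (2:ℝ)⁻¹ • (P + Q) ∈ tri A B C := by
    intro P Q hP hQ
    rw [smul_add]
    exact convex_tri A B C hP hQ (by norm_num) (by norm_num) (by norm_num)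
  unfold subV
  split_ifs <;> simp only [mid, hA, hB, hC, and_self]

theorem subTri_subset (v : Pt × Pt × Pt) (l : List (F2 × F2)) :
    subTri v l ⊆ tri v.1 v.2.1 v.2.2 := by
  induction l generalizing v with
  | nil => exact subset_rfl
  | cons ξ l ih =>
    obtain ⟨h1, h2, h3⟩ := subV_mem_tri v ξ
    exact (ih (subV v ξ)).trans (tri_subset_of_convex (convex_tri _ _ _) h1 h2 h3)

theorem exists_subV_eq (v : Pt × Pt × Pt) (ξ : F2 × F2) : ∃ (p : Pt) (s : ℝ),
    |s| = 2⁻¹ ∧ subV v ξ = (p + s • v.1, p + s • v.2.1, p + s • v.2.2) := by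
  obtain ⟨A, B, C⟩ := v
  unfold subV
  split_ifs
  · exact ⟨(2:ℝ)⁻¹ • A, 2⁻¹, by norm_num, Prod.ext (by module) (Prod.ext (by module) (by module))⟩
  · exact ⟨(2:ℝ)⁻¹ • B, 2⁻¹, by norm_num, Prod.ext (by module) (Prod.ext (by module) (by module))⟩
  · exact ⟨(2:ℝ)⁻¹ • C, 2⁻¹, by norm_num, Prod.ext (by module) (Prod.ext (by module) (by module))⟩
  · exact ⟨(2:ℝ)⁻¹ • (A + B + C), -2⁻¹, by norm_num, Prod.ext (by module) (Prod.ext (by module) (by module))⟩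

theorem exists_vIter_eq (v : Pt × Pt × Pt) (l : List (F2 × F2)) : ∃ (p : Pt) (s : ℝ),
    |s| = (2 ^ l.length)⁻¹ ∧ vIter v l = (p + s • v.1, p + s • v.2.1, p + s • v.2.2) := by
  induction l generalizing v with
  | nil => exact ⟨0, 1, by simp, by simp [vIter]⟩
  | cons ξ l ih =>
    obtain ⟨p, s, hs, h⟩ := ih (subV v ξ)
    obtain ⟨q, t, ht, h'⟩ := exists_subV_eq v ξ
    refine ⟨p + s • q, s * t, ?_, ?_⟩
    · rw [abs_mul, hs, ht, List.length_cons, pow_succ, mul_inv]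
    · change vIter (subV v ξ) l = _
      rw [h, h']
      simp only [smul_add, smul_smul, add_assoc]

theorem tri_add_smul (A B C p : Pt) (s : ℝ) :
    tri (p + s • A) (p + s • B) (p + s • C) = (fun x => p + s • x) '' tri A B C := by
  ext x
  constructor
  · rintro ⟨w1, w2, w3, h1, h2, h3, h, rfl⟩
    refine ⟨_, ⟨w1, w2, w3, h1, h2, h3, h, rfl⟩, ?_⟩
    have hp : p = (w1 + w2 + w3) • p := by rw [h, one_smul]
    dsimp only
    nth_rewrite 1 [hp]
    module
  · rintro ⟨_, ⟨w1, w2, w3, h1, h2, h3, h, rfl⟩, rfl⟩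
    refine ⟨w1, w2, w3, h1, h2, h3, h, ?_⟩
    have hp : p = (w1 + w2 + w3) • p := by rw [h, one_smul]
    dsimp only
    nth_rewrite 1 [hp]
    module

theorem exists_subTri_eq_image (v : Pt × Pt × Pt) (l : List (F2 × F2)) :
    ∃ (p : Pt) (s : ℝ), |s| = (2 ^ l.length)⁻¹ ∧
      subTri v l = (fun x => p + s • x) '' tri v.1 v.2.1 v.2.2 := by
  obtain ⟨p, s, hs, h⟩ := exists_vIter_eq v l
  refine ⟨p, s, hs, ?_⟩
  rw [subTri, h, tri_add_smul]

theorem norm_sub_le_of_mem_subTri {v : Pt × Pt × Pt} {l : List (F2 × F2)} {x y : Pt}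
    (hx : x ∈ subTri v l) (hy : y ∈ subTri v l) :
    ‖x - y‖ ≤ Metric.diam (tri v.1 v.2.1 v.2.2) / 2 ^ l.length := by
  obtain ⟨p, s, hs, h⟩ := exists_subTri_eq_image v l
  rw [h] at hx hy
  obtain ⟨x, hx, rfl⟩ := hx
  obtain ⟨y, hy, rfl⟩ := hy
  have hxy : ‖x - y‖ ≤ Metric.diam (tri v.1 v.2.1 v.2.2) := by
    rw [← dist_eq_norm]
    exact Metric.dist_le_diam_of_mem (isCompact_tri _ _ _).isBounded hx hy
  rw [add_sub_add_left_eq_sub, ← smul_sub, norm_smul, Real.norm_eq_abs, hs, div_eq_inv_mul]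
  gcongr

theorem volume_subTri_ne_zero {A B C : Pt} (hT : AffineIndependent ℝ ![A, B, C])
    (l : List (F2 × F2)) : volume (subTri (A, B, C) l) ≠ 0 := by
  obtain ⟨p, s, hs, h⟩ := exists_subTri_eq_image (A, B, C) l
  have hs0 : s ≠ 0 := by
    rw [← abs_pos, hs]
    positivity
  have hpos : volume (tri A B C) ≠ 0 :=
    (Measure.measure_pos_of_nonempty_interior volume (interior_tri_nonempty hT)).ne'
  have himg : (fun x => p + s • x) '' tri A B C =
      (fun x => p + x) '' ((fun x => s • x) '' tri A B C) := by
    rw [Set.image_image]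
  rw [h, himg, Set.image_add_left, measure_preimage_add, Set.image_smul,
    Measure.addHaar_smul]
  simp [hs0, hpos]

theorem abs_le_supAbs {s : Set Pt} (hs : IsCompact s) {g : Pt → ℝ} (hg : ContinuousOn g s)
    {x : Pt} (hx : x ∈ s) : |g x| ≤ supAbs s g := by
  obtain ⟨K, hK⟩ := hs.exists_bound_of_continuousOn hg
  have hK0 : 0 ≤ K := (norm_nonneg _).trans (hK x hx)
  have hbdd : BddAbove (Set.range fun z => ⨆ _ : z ∈ s, |g z|) := by
    refine ⟨K, ?_⟩
    rintro _ ⟨z, rfl⟩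
    exact Real.iSup_le (fun hz => hK z hz) hK0
  have := le_ciSup hbdd x
  simpa [hx, supAbs] using this

theorem norm_le_sqrt_two_mul {L : Pt →L[ℝ] ℝ} {M : ℝ} (h1 : |L dir1| ≤ M) (h2 : |L dir2| ≤ M) :
    ‖L‖ ≤ Real.sqrt 2 * M := by
  have hM : 0 ≤ M := (abs_nonneg _).trans h1
  refine L.opNorm_le_bound (by positivity) fun v => ?_
  have hv : v = v 0 • dir1 + v 1 • dir2 := by
    ext i
    fin_cases i <;> simp [dir1, dir2]
  have hsum : |v 0| + |v 1| ≤ Real.sqrt 2 * ‖v‖ := by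
    rw [EuclideanSpace.norm_eq, ← Real.sqrt_mul (by norm_num)]
    apply Real.le_sqrt_of_sq_le
    simp only [Fin.sum_univ_two, Real.norm_eq_abs]
    nlinarith [sq_nonneg (|v 0| - |v 1|)]
  calc ‖L v‖ = |v 0 * L dir1 + v 1 * L dir2| := by
        conv_lhs => rw [hv]
        simp
    _ ≤ |v 0| * |L dir1| + |v 1| * |L dir2| := by
        rw [← abs_mul, ← abs_mul]
        exact abs_add_le _ _
    _ ≤ |v 0| * M + |v 1| * M := by gcongr
    _ = (|v 0| + |v 1|) * M := by ring
    _ ≤ Real.sqrt 2 * ‖v‖ * M := by gcongr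
    _ = Real.sqrt 2 * M * ‖v‖ := by ring

theorem norm_fderivWithin_le_c2Norm {s : Set Pt} (hs : IsCompact s) (hu : UniqueDiffOn ℝ s)
    {f : Pt → ℝ} (hf : ContDiffOn ℝ 2 f s) {x : Pt} (hx : x ∈ s) :
    ‖fderivWithin ℝ f s x‖ ≤ Real.sqrt 2 * c2Norm s f := by
  have hc : ContinuousOn (fderivWithin ℝ f s) s :=
    hf.continuousOn_fderivWithin hu (by norm_num)
  have hpd : ∀ v, |fderivWithin ℝ f s x v| ≤ supAbs s (pdW s v f) := fun v =>
    abs_le_supAbs (g := pdW s v f) hs (hc.clm_apply continuousOn_const) hx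
  refine norm_le_sqrt_two_mul ((hpd dir1).trans ?_) ((hpd dir2).trans ?_) <;> simp [c2Norm]


/-- Lemma 4. The discretized function approximates `f` well:
`|f(y) - F_n(X)| ≤ √2 d(T) ‖f‖_{C²(T)} / 2^n` for `y ∈ T^{(n)}(X)`. -/
theorem statement9 (A B C : Pt) (hT : AffineIndependent ℝ ![A, B, C]) {n : ℕ}
    (X : Fin n → F2 × F2) (y : Pt) (hy : y ∈ subTri (A, B, C) (List.ofFn X))
    (f : Pt → ℝ) (hf : ContDiffOn ℝ 2 f (tri A B C)) :
    |f y - discF (A, B, C) f X| ≤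
      Real.sqrt 2 * Metric.diam (tri A B C) * c2Norm (tri A B C) f / 2 ^ n := by
  have hK := isCompact_tri A B C
  have hu := uniqueDiffOn_convex (convex_tri A B C) (interior_tri_nonempty hT)
  have hsub : subTri (A, B, C) (List.ofFn X) ⊆ tri A B C := subTri_subset (A, B, C) _
  have hKs : IsCompact (subTri (A, B, C) (List.ofFn X)) := isCompact_tri _ _ _
  have hM : 0 ≤ Real.sqrt 2 * c2Norm (tri A B C) f :=
    (norm_nonneg _).trans (norm_fderivWithin_le_c2Norm hK hu hf (hsub hy))
  have hball : ∀ x ∈ subTri (A, B, C) (List.ofFn X), f x ∈ Metric.closedBall (f y)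
      (Real.sqrt 2 * Metric.diam (tri A B C) * c2Norm (tri A B C) f / 2 ^ n) := by
    intro x hx
    have hxy := norm_sub_le_of_mem_subTri hx hy
    rw [List.length_ofFn] at hxy
    rw [mem_closedBall_iff_norm]
    calc ‖f x - f y‖ ≤ Real.sqrt 2 * c2Norm (tri A B C) f * ‖x - y‖ :=
          (convex_tri A B C).norm_image_sub_le_of_norm_fderivWithin_le
            (hf.differentiableOn (by norm_num))
            (fun z hz => norm_fderivWithin_le_c2Norm hK hu hf hz) (hsub hy) (hsub hx)
      _ ≤ Real.sqrt 2 * c2Norm (tri A B C) f * (Metric.diam (tri A B C) / 2 ^ n) := by gcongr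
      _ = _ := by ring
  have havg := (convex_closedBall _ _).set_average_mem Metric.isClosed_closedBall
    (volume_subTri_ne_zero hT (List.ofFn X)) hKs.measure_lt_top.ne
    (ae_restrict_of_forall_mem hKs.measurableSet hball)
    ((hf.continuousOn.mono hsub).integrableOn_compact hKs)
  rw [setAverage_eq, mem_closedBall_iff_norm'] at havg
  exact havg

end
end

section
/- Let T = △(e(1,0), e(0,1), e(1,1)) with e(1,0)+e(0,1)+e(1,1) = (0,0) and e(0,0) := (0,0). Let κ ∈ 𝔽₂²∖{(0,0)}, X = (ξ_i)_{i=1}^n ∈ 𝔽₂^{n×2} with rows ξ_i, and 1 ≤ i ≤ n with ξ_i ∉ {(0,0), κ}. Then T^{(n)}(X ⊕_i κ) = (η_i(X)/2^i)·τ(κ, ξ_i) + T^{(n)}(X), i.e. T^{(n)}(X ⊕_i κ) is the translate of T^{(n)}(X) by the vector (η_i(X)/2^i)·τ(κ, ξ_i). -/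
open MeasureTheory

noncomputable section

/-- The vertex triple of the reference triangle scaled by `s` and moved to the centre `c`. -/
def frame (e : F2 × F2 → Pt) (c : Pt) (s : ℝ) : Pt × Pt × Pt :=
  (c + s • e (1, 0), c + s • e (0, 1), c + s • e (1, 1))

theorem subV_frame (e : F2 × F2 → Pt) (he0 : e (0, 0) = 0)
    (hsum : e (1, 0) + e (0, 1) + e (1, 1) = 0) (c : Pt) (s : ℝ) (ξ : F2 × F2) :
    subV (frame e c s) ξ =
      frame e (c + (s / 2) • e ξ) ((if ξ = (0, 0) then -1 else 1) * s / 2) := by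
  have h11 : e (1, 1) = -e (1, 0) - e (0, 1) := by
    rw [← sub_eq_zero, ← hsum]; abel
  have hξ : ∀ ξ : F2 × F2, ξ = (0, 0) ∨ ξ = (1, 0) ∨ ξ = (0, 1) ∨ ξ = (1, 1) := by decide
  rcases hξ ξ with rfl | rfl | rfl | rfl <;>
    simp only [subV, frame, he0, h11, Prod.mk.injEq, zero_ne_one, one_ne_zero, and_true, and_false,
      and_self, if_true, if_false] <;>
    refine ⟨?_, ?_, ?_⟩ <;> module

/-- Translation of a vertex triple by `d`. -/
def translateV (d : Pt) (v : Pt × Pt × Pt) : Pt × Pt × Pt := (d + v.1, d + v.2.1, d + v.2.2)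

theorem translateV_frame (e : F2 × F2 → Pt) (d c : Pt) (s : ℝ) :
    translateV d (frame e c s) = frame e (d + c) s := by
  simp only [translateV, frame, add_assoc]

theorem subV_translateV (d : Pt) (v : Pt × Pt × Pt) (ξ : F2 × F2) :
    subV (translateV d v) ξ = translateV d (subV v ξ) := by
  unfold subV translateV
  split_ifs <;> refine Prod.ext ?_ (Prod.ext ?_ ?_) <;> dsimp only <;> module

theorem vIter_translateV (d : Pt) (l : List (F2 × F2)) (v : Pt × Pt × Pt) :
    vIter (translateV d v) l = translateV d (vIter v l) := by
  induction l generalizing v with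
  | nil => rfl
  | cons ξ l ih =>
    change vIter (subV (translateV d v) ξ) l = translateV d (vIter (subV v ξ) l)
    rw [subV_translateV, ih]

theorem tri_translate (d A B C : Pt) :
    tri (d + A) (d + B) (d + C) = (fun y => d + y) '' tri A B C := by
  have key (w1 w2 w3 : ℝ) (h : w1 + w2 + w3 = 1) :
      w1 • (d + A) + w2 • (d + B) + w3 • (d + C) = d + (w1 • A + w2 • B + w3 • C) := by
    obtain rfl : w3 = 1 - w1 - w2 := by linarith
    module
  ext x
  constructor
  · rintro ⟨w1, w2, w3, h1, h2, h3, h, rfl⟩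
    exact ⟨_, ⟨w1, w2, w3, h1, h2, h3, h, rfl⟩, (key w1 w2 w3 h).symm⟩
  · rintro ⟨_, ⟨w1, w2, w3, h1, h2, h3, h, rfl⟩, rfl⟩
    exact ⟨w1, w2, w3, h1, h2, h3, h, (key w1 w2 w3 h).symm⟩

theorem vIter_append (v : Pt × Pt × Pt) (l₁ l₂ : List (F2 × F2)) :
    vIter v (l₁ ++ l₂) = vIter (vIter v l₁) l₂ :=
  List.foldl_append

theorem eta_one {n : ℕ} (X : Fin n → F2 × F2) : eta X 1 = 1 := by
  simp [eta]

theorem eta_succ {n : ℕ} (X : Fin n → F2 × F2) (k : Fin n) :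
    eta X (k + 2) = (if X k = (0, 0) then -1 else 1) * eta X (k + 1) := by
  unfold eta
  by_cases hk : X k = (0, 0)
  · have hins : (Finset.univ.filter fun a : Fin n => (a : ℕ) + 1 < k + 2 ∧ X a = (0, 0)) =
        insert k (Finset.univ.filter fun a : Fin n => (a : ℕ) + 1 < k + 1 ∧ X a = (0, 0)) := by
      ext a
      simp only [Finset.mem_filter, Finset.mem_univ, true_and, Finset.mem_insert]
      constructor
      · rintro ⟨h, ha⟩
        by_cases hak : a = k
        · exact Or.inl hak
        · exact Or.inr ⟨by omega, ha⟩
      · rintro (rfl | ⟨h, ha⟩)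
        · exact ⟨by omega, hk⟩
        · exact ⟨by omega, ha⟩
    rw [hins, Finset.card_insert_of_notMem (by simp), if_pos hk, pow_succ']
  · rw [if_neg hk, one_mul]
    congr 2
    ext a
    simp only [Finset.mem_filter, Finset.mem_univ, true_and]
    constructor
    · rintro ⟨h, ha⟩
      have hak : a ≠ k := by rintro rfl; exact hk ha
      exact ⟨by omega, ha⟩
    · rintro ⟨h, ha⟩
      exact ⟨by omega, ha⟩

theorem exists_vIter_take_eq_frame (e : F2 × F2 → Pt) (he0 : e (0, 0) = 0)
    (hsum : e (1, 0) + e (0, 1) + e (1, 1) = 0) {n : ℕ} (X : Fin n → F2 × F2) (k : ℕ)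
    (hk : k ≤ n) :
    ∃ c, vIter (e (1, 0), e (0, 1), e (1, 1)) ((List.ofFn X).take k) =
      frame e c (eta X (k + 1) / 2 ^ k) := by
  induction k with
  | zero => exact ⟨0, by simp [vIter, frame, eta_one]⟩
  | succ k ih =>
    obtain ⟨c, hc⟩ := ih (by omega)
    refine ⟨c + (eta X (k + 1) / 2 ^ k / 2) • e (X ⟨k, hk⟩), ?_⟩
    have htake : (List.ofFn X).take (k + 1) = (List.ofFn X).take k ++ [X ⟨k, hk⟩] := by
      rw [List.take_succ_eq_append_getElem (by simpa using hk), List.getElem_ofFn]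
    rw [htake, vIter_append, hc]
    change subV _ _ = _
    rw [subV_frame e he0 hsum, eta_succ X ⟨k, hk⟩]
    congr 1
    rw [pow_succ]
    ring

theorem ofFn_update_eq_append {n : ℕ} (X : Fin n → F2 × F2) (i : Fin n) (ζ : F2 × F2) :
    List.ofFn (Function.update X i ζ) =
      (List.ofFn X).take i ++ ζ :: (List.ofFn X).drop (i + 1) := by
  have hset : List.ofFn (Function.update X i ζ) = (List.ofFn X).set i ζ := by
    apply List.ext_getElem
    · simp
    · intro j h₁ h₂
      simp [List.getElem_set, Function.update_apply, Fin.ext_iff, eq_comm]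
  rw [hset, List.set_eq_take_append_cons_drop, if_pos (by simp)]

/-- Lemma 5, part 1. If the `i`-th row of `X` is neither `0` nor `κ`,
then `T^{(n)}(X ⊕_i κ)` is the translate of `T^{(n)}(X)` by `(η_i(X)/2^i) τ(κ, ξ_i)`.
(Here `i : Fin n` is the 0-indexed row, corresponding to the paper's index `i+1`.) -/
theorem statement12 (e : F2 × F2 → Pt) (he0 : e (0, 0) = 0)
    (hsum : e (1, 0) + e (0, 1) + e (1, 1) = 0)
    {n : ℕ} (κ : F2 × F2) (hκ : κ ≠ (0, 0)) (X : Fin n → F2 × F2) (i : Fin n)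
    (hξ : X i ≠ (0, 0) ∧ X i ≠ κ) :
    subTri (e (1, 0), e (0, 1), e (1, 1)) (List.ofFn (Function.update X i (X i + κ))) =
      (fun y => (eta X ((i : ℕ) + 1) / 2 ^ ((i : ℕ) + 1)) • tau e κ (X i) + y) ''
        subTri (e (1, 0), e (0, 1), e (1, 1)) (List.ofFn X) := by
  obtain ⟨c, hc⟩ := exists_vIter_take_eq_frame e he0 hsum X i i.isLt.le
  have hne : X i + κ ≠ (0, 0) := by
    have h : ∀ a b : F2 × F2, a + b = (0, 0) → a = b := by decide
    exact fun h0 => hξ.2 (h _ _ h0)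
  have hiter (ζ : F2 × F2) (hζ : ζ ≠ (0, 0)) :
      vIter (e (1, 0), e (0, 1), e (1, 1)) (List.ofFn (Function.update X i ζ)) =
        vIter (frame e (c + (eta X (i + 1) / 2 ^ (i : ℕ) / 2) • e ζ)
          (1 * (eta X (i + 1) / 2 ^ (i : ℕ)) / 2)) ((List.ofFn X).drop (i + 1)) := by
    rw [ofFn_update_eq_append, vIter_append, hc]
    change vIter (subV _ ζ) _ = _
    rw [subV_frame e he0 hsum, if_neg hζ]
  have hX := hiter (X i) hξ.1
  rw [Function.update_eq_self] at hX
  rw [tau, if_pos hξ, subTri, subTri, ← tri_translate, hiter _ hne, hX]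
  set d : Pt := (eta X (i + 1) / 2 ^ ((i : ℕ) + 1)) • (e (κ + X i) - e (X i)) with hd
  have hcentre : c + (eta X (i + 1) / 2 ^ (i : ℕ) / 2) • e (X i + κ) =
      d + (c + (eta X (i + 1) / 2 ^ (i : ℕ) / 2) • e (X i)) := by
    rw [hd, add_comm κ, pow_succ, ← div_div]
    module
  rw [hcentre, ← translateV_frame, vIter_translateV]
  rfl
end
end
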